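/- arXiv:1810.11243 — 4 statements merged into one kernel-verified Lean document; each statement's English description precedes it below -/
import Mathlib

section
/- For any SMDP M, scheduler σ for M, and state s, the time-bounded cylinder probability satisfies the inductive characterisation: P^σ(s)(a₁, t) = ∑_{s'∈S} τ^σ(s,a₁)(s') · ρ(s)([0,t]) for all a₁ ∈ L and t ≥ 0, and for every n ≥ 1, word a₁a₂…a_{n+1} ∈ L^{n+1}, and t ≥ 0, P^σ(s)(a₁a₂…a_{n+1}, t) = ∑_{s'∈S} τ^σ(s,a₁)(s') · ∫_{[0,t]} P^σ(s')(a₂…a_{n+1}, t − x) dρ(s)(x). -/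
open MeasureTheory Set
open scoped NNReal ENNReal

/-- Convolution of two measures on `ℝ≥0`: the pushforward of the product measure under
addition. -/
noncomputable def mconv (μ ν : Measure ℝ≥0) : Measure ℝ≥0 :=
  (μ.prod ν).map (fun p => p.1 + p.2)

/-- A semi-Markov decision process over the label set `L`. -/
structure SMDP (L : Type) where
  /-- the (nonempty, countable) set of states -/
  S : Type
  countS : Countable S
  neS : Nonempty S
  /-- the start state -/
  init : S
  /-- the transition probability function -/
  τ : S → L → S → ℝ≥0
  sub_prob : ∀ s a, (∑' s', (τ s a s' : ℝ≥0∞)) ≤ 1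
  /-- the residence-time probability function -/
  ρ : S → Measure ℝ≥0
  ρ_prob : ∀ s, IsProbabilityMeasure (ρ s)

attribute [instance] SMDP.countS SMDP.neS SMDP.ρ_prob

variable {L : Type}

/-- A (memoryless stochastic) scheduler for an SMDP. -/
structure Scheduler (M : SMDP L) where
  f : M.S → L → ℝ≥0
  sum_one : ∀ s, (∑' a, (f s a : ℝ≥0∞)) = 1

/-- `τ^σ(s,a)(s') = τ(s,a)(s') · σ(s)(a)`. -/
def schedTau (M : SMDP L) (σ : Scheduler M) (s : M.S) (a : L) (s' : M.S) : ℝ≥0 :=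
  M.τ s a s' * σ.f s a

/-- `convAlong M s [s₁, …, sₖ] = ρ(s) ∗ ρ(s₁) ∗ ⋯ ∗ ρ(sₖ)`. -/
noncomputable def convAlong (M : SMDP L) : M.S → List M.S → Measure ℝ≥0
  | s, [] => M.ρ s
  | s, s' :: rest => mconv (M.ρ s) (convAlong M s' rest)

/-- The product `τ^σ(s,a₁)(s₁) ⋯ τ^σ(s_{n−1},aₙ)(sₙ)` along a word and a matching
list of states (and `0` if the lengths do not match). -/
noncomputable def pathWeight (M : SMDP L) (σ : Scheduler M) : M.S → List L → List M.S → ℝ≥0∞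
  | _, [], [] => 1
  | s, a :: w, s' :: p => (schedTau M σ s a s' : ℝ≥0∞) * pathWeight M σ s' w p
  | _, _, _ => 0

/-- The time-bounded cylinder probability
`P^σ_M(s)(a₁…aₙ, t) = ∑_{s₁,…,sₙ} τ^σ(s,a₁)(s₁) ⋯ τ^σ(s_{n−1},aₙ)(sₙ) ·
(ρ(s) ∗ ρ(s₁) ∗ ⋯ ∗ ρ(s_{n−1}))([0,t])`. -/
noncomputable def cylP (M : SMDP L) (σ : Scheduler M) (s : M.S) (w : List L) (t : ℝ≥0) : ℝ≥0∞ :=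
  ∑' p : List M.S, pathWeight M σ s w p * convAlong M s p.dropLast (Set.Iic t)

/-- `U ⪯ V`: the faster-than relation. -/
def Faster (U V : SMDP L) : Prop :=
  ∀ (σ : Scheduler V) (w : List L), w ≠ [] → ∀ t : ℝ≥0,
    ∃ (σ' : Scheduler U) (t' : ℝ≥0), t' ≤ t ∧
      cylP V σ V.init w t ≤ cylP U σ' U.init w t'

/-- A sum over lists splits into the empty list and the lists with a given head. -/
lemma ENNReal.tsum_list {α : Type*} (f : List α → ℝ≥0∞) :
    ∑' p, f p = f [] + ∑' x, ∑' p, f (x :: p) := by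
  let e : Unit ⊕ α × List α ≃ List α :=
    { toFun := Sum.elim (fun _ => []) fun q => q.1 :: q.2
      invFun := fun p => p.casesOn (.inl ()) fun x p => .inr (x, p)
      left_inv := by rintro (_ | _) <;> rfl
      right_inv := by rintro (_ | _) <;> rfl }
  rw [← e.tsum_eq, ENNReal.summable.tsum_sum ENNReal.summable, ENNReal.tsum_prod']
  simp [e]

lemma mconv_apply_Iic (μ ν : Measure ℝ≥0) [SFinite ν] (t : ℝ≥0) :
    mconv μ ν (Iic t) = ∫⁻ x in Iic t, ν (Iic (t - x)) ∂μ := by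
  have hm : Measurable fun p : ℝ≥0 × ℝ≥0 => p.1 + p.2 := measurable_fst.add measurable_snd
  rw [mconv, Measure.map_apply hm measurableSet_Iic, Measure.prod_apply (hm measurableSet_Iic),
    ← lintegral_indicator measurableSet_Iic]
  refine lintegral_congr fun x => ?_
  by_cases hx : x ≤ t
  · rw [indicator_of_mem (mem_Iic.2 hx)]
    congr 1
    ext y
    exact (le_tsub_iff_left hx).symm
  · rw [indicator_of_notMem (by simpa using hx)]
    convert measure_empty (μ := ν)
    refine eq_empty_of_forall_notMem fun y hy => hx ?_
    exact le_self_add.trans (mem_Iic.1 hy)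

instance isProbabilityMeasure_convAlong (M : SMDP L) (s : M.S) (p : List M.S) :
    IsProbabilityMeasure (convAlong M s p) := by
  induction p generalizing s with
  | nil => exact M.ρ_prob s
  | cons s' p ih =>
    have := ih s'
    exact Measure.isProbabilityMeasure_map (measurable_fst.add measurable_snd).aemeasurable

lemma cylP_cons (M : SMDP L) (σ : Scheduler M) (s : M.S) (a : L) (w : List L) (t : ℝ≥0) :
    cylP M σ s (a :: w) t = ∑' s' : M.S, (schedTau M σ s a s' : ℝ≥0∞) *
      ∑' p : List M.S, pathWeight M σ s' w p * convAlong M s (s' :: p).dropLast (Iic t) := by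
  rw [cylP, ENNReal.tsum_list]
  simp [pathWeight, mul_assoc, ENNReal.tsum_mul_left]

lemma measurable_measure_Iic_tsub (ν : Measure ℝ≥0) (t : ℝ≥0) :
    Measurable fun x : ℝ≥0 => ν (Iic (t - x)) :=
  Antitone.measurable fun _ _ h => measure_mono (Iic_subset_Iic.2 (tsub_le_tsub_left h t))

/-- The inductive characterisation of the time-bounded cylinder probabilities:
`P^σ(s)(a₁, t) = ∑_{s'} τ^σ(s,a₁)(s') · ρ(s)([0,t])` and
`P^σ(s)(a₁a₂…a_{n+1}, t) = ∑_{s'} τ^σ(s,a₁)(s') · ∫_{[0,t]} P^σ(s')(a₂…a_{n+1}, t − x) dρ(s)(x)`. -/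
theorem cylP_inductive (L : Type) [Countable L] [Nonempty L]
    (M : SMDP L) (σ : Scheduler M) (s : M.S) :
    (∀ (a₁ : L) (t : ℝ≥0),
      cylP M σ s [a₁] t
        = ∑' s' : M.S, (schedTau M σ s a₁ s' : ℝ≥0∞) * M.ρ s (Set.Iic t)) ∧
    (∀ (a₁ a₂ : L) (w : List L) (t : ℝ≥0),
      cylP M σ s (a₁ :: a₂ :: w) t
        = ∑' s' : M.S, (schedTau M σ s a₁ s' : ℝ≥0∞) *
            ∫⁻ x in Set.Iic t, cylP M σ s' (a₂ :: w) (t - x) ∂(M.ρ s)) := by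
  refine ⟨fun a₁ t => ?_, fun a₁ a₂ w t => ?_⟩
  · rw [cylP_cons]
    refine tsum_congr fun s' => ?_
    rw [ENNReal.tsum_list]
    simp [pathWeight, convAlong]
  · rw [cylP_cons]
    refine tsum_congr fun s' => ?_
    congr 1
    simp only [cylP]
    rw [lintegral_tsum fun p =>
      ((measurable_measure_Iic_tsub _ t).const_mul _).aemeasurable]
    refine tsum_congr fun p => ?_
    rw [lintegral_const_mul _ (measurable_measure_Iic_tsub _ t)]
    cases p with
    | nil => simp [pathWeight]
    | cons s'' p =>
      rw [List.dropLast_cons_cons, convAlong, mconv_apply_Iic]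
end

section
/- Parallel timing anomaly for product composition: let Exp(θ) denote the exponential probability measure on [0,∞) with rate θ (CDF 1 − e^{−θt}), and let ∗ denote convolution of measures on [0,∞). Then (Exp(20) ∗ Exp(0.05))([0,2]) < (Exp(5) ∗ Exp(0.2))([0,2]), even though Exp(2)([0,t]) ≥ Exp(0.5)([0,t]) and Exp(2·10)([0,t]) ≥ Exp(0.5·10)([0,t]) for all t ≥ 0. (Here 20 = 2·10 and 0.05 = 0.5·0.1 are the product-composed rates of the faster component with the context, and 5 = 0.5·10 and 0.2 = 2·0.1 those of the slower component, witnessing that the composed faster process fails to dominate on the cylinder of two a-steps within time 2.) -/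
open MeasureTheory Set
open scoped NNReal ENNReal

/-- Truncating only the second summand bounds the convolution from above. -/
theorem mconv_Iic_le (μ ν : Measure ℝ≥0) [IsProbabilityMeasure μ] [SFinite ν] (t : ℝ≥0) :
    mconv μ ν (Iic t) ≤ ν (Iic t) := by
  rw [mconv, Measure.map_apply (by fun_prop) measurableSet_Iic]
  calc (μ.prod ν) ((fun p : ℝ≥0 × ℝ≥0 => p.1 + p.2) ⁻¹' Iic t)
      ≤ (μ.prod ν) (univ ×ˢ Iic t) :=
        measure_mono fun p hp => ⟨mem_univ _, mem_Iic.2 (le_add_self.trans (mem_Iic.1 hp))⟩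
    _ = ν (Iic t) := by rw [Measure.prod_prod, measure_univ, one_mul]

/-- Truncating both summands separately bounds the convolution from below. -/
theorem mul_le_mconv_Iic_add (μ ν : Measure ℝ≥0) [SFinite ν] (s t : ℝ≥0) :
    μ (Iic s) * ν (Iic t) ≤ mconv μ ν (Iic (s + t)) := by
  rw [mconv, Measure.map_apply (by fun_prop) measurableSet_Iic, ← Measure.prod_prod]
  exact measure_mono fun p hp => mem_Iic.2 (add_le_add (mem_Iic.1 hp.1) (mem_Iic.1 hp.2))

/-- A lower bound for the exponential distribution function. -/
theorem div_one_add_le_one_sub_exp_neg {x : ℝ} (hx : 0 ≤ x) :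
    x / (1 + x) ≤ 1 - Real.exp (-x) := by
  have h : Real.exp (-x) ≤ (1 + x)⁻¹ := by
    rw [Real.exp_neg]
    exact inv_anti₀ (by positivity) (by linarith [Real.add_one_le_exp x])
  have h' : x / (1 + x) = 1 - (1 + x)⁻¹ := by field_simp; ring
  linarith

/-- Parallel timing anomaly for product composition: even though `Exp 2` dominates
`Exp 0.5` and `Exp (2·10) = Exp 20` dominates `Exp (0.5·10) = Exp 5` pointwise, the
convolution `Exp 20 ∗ Exp 0.05` assigns less probability to `[0,2]` than
`Exp 5 ∗ Exp 0.2` does. -/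
theorem product_composition_timing_anomaly
    (e20 e005 e5 e02 e2 e05 : Measure ℝ≥0)
    (h20p : IsProbabilityMeasure e20) (h005p : IsProbabilityMeasure e005)
    (h5p : IsProbabilityMeasure e5) (h02p : IsProbabilityMeasure e02)
    (h2p : IsProbabilityMeasure e2) (h05p : IsProbabilityMeasure e05)
    (h20 : ∀ t : ℝ≥0, e20 (Set.Iic t) = ENNReal.ofReal (1 - Real.exp (-(20 * t))))
    (h005 : ∀ t : ℝ≥0, e005 (Set.Iic t) = ENNReal.ofReal (1 - Real.exp (-((1/20) * t))))
    (h5 : ∀ t : ℝ≥0, e5 (Set.Iic t) = ENNReal.ofReal (1 - Real.exp (-(5 * t))))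
    (h02 : ∀ t : ℝ≥0, e02 (Set.Iic t) = ENNReal.ofReal (1 - Real.exp (-((1/5) * t))))
    (h2 : ∀ t : ℝ≥0, e2 (Set.Iic t) = ENNReal.ofReal (1 - Real.exp (-(2 * t))))
    (h05 : ∀ t : ℝ≥0, e05 (Set.Iic t) = ENNReal.ofReal (1 - Real.exp (-((1/2) * t)))) :
    (∀ t : ℝ≥0, e05 (Set.Iic t) ≤ e2 (Set.Iic t)) ∧
    (∀ t : ℝ≥0, e5 (Set.Iic t) ≤ e20 (Set.Iic t)) ∧
    mconv e20 e005 (Set.Iic 2) < mconv e5 e02 (Set.Iic 2) := by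
  refine ⟨fun t => ?_, fun t => ?_, ?_⟩
  · rw [h05, h2]
    gcongr
    norm_num
  · rw [h5, h20]
    gcongr
    norm_num
  · have upper : mconv e20 e005 (Iic 2) ≤ ENNReal.ofReal (1 / 10) := by
      refine (mconv_Iic_le e20 e005 2).trans ?_
      rw [h005]
      refine ENNReal.ofReal_le_ofReal ?_
      have := Real.add_one_le_exp (-((1 / 20) * ((2 : ℝ≥0) : ℝ)))
      push_cast at this ⊢
      linarith
    have lower : ENNReal.ofReal (5 / 6 * (1 / 6)) ≤ mconv e5 e02 (Iic 2) := by
      rw [← one_add_one_eq_two]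
      refine le_trans ?_ (mul_le_mconv_Iic_add e5 e02 1 1)
      rw [ENNReal.ofReal_mul (by norm_num), h5, h02]
      refine mul_le_mul' (ENNReal.ofReal_le_ofReal ?_) (ENNReal.ofReal_le_ofReal ?_)
      · have := div_one_add_le_one_sub_exp_neg (x := 5 * ((1 : ℝ≥0) : ℝ)) (by positivity)
        refine le_trans ?_ this
        norm_num
      · have := div_one_add_le_one_sub_exp_neg (x := 1 / 5 * ((1 : ℝ≥0) : ℝ)) (by positivity)
        refine le_trans ?_ this
        norm_num
    refine upper.trans_lt (lt_of_lt_of_le ?_ lower)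
    exact (ENNReal.ofReal_lt_ofReal_iff (by norm_num)).2 (by norm_num)
end

section
/- Parallel timing anomaly for minimum composition: let Exp(θ) denote the exponential probability measure on [0,∞) with rate θ (CDF 1 − e^{−θt}), and let ∗ denote convolution of measures on [0,∞). Then (Exp(1) ∗ Exp(0.5))([0,2]) < (Exp(0.5) ∗ Exp(2))([0,2]), even though Exp(2)([0,t]) ≥ Exp(0.5)([0,t]) for all t ≥ 0. (Here Exp(1) = min-composition of Exp(2) and Exp(1), Exp(0.5) = min-composition of Exp(0.5) and Exp(2), etc., where the minimum composition of two measures has CDF the pointwise minimum of their CDFs; the inequality witnesses that the composed faster process fails to dominate on the cylinder of two a-steps within time 2.) -/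
open MeasureTheory Set
open scoped NNReal ENNReal

theorem mconv_Iic_eq_lintegral (μ ν : Measure ℝ≥0) [SFinite ν] (a : ℝ≥0) :
    mconv μ ν (Iic a) = ∫⁻ x, ν {y | x + y ≤ a} ∂μ := by
  rw [mconv, Measure.map_apply (by fun_prop) measurableSet_Iic,
    Measure.prod_apply (measurableSet_Iic.preimage (by fun_prop))]
  rfl

theorem mconv_comm (μ ν : Measure ℝ≥0) [SFinite μ] [SFinite ν] : mconv μ ν = mconv ν μ := by
  rw [mconv, mconv, ← Measure.prod_swap, Measure.map_map (by fun_prop) measurable_swap]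
  congr 1
  ext p
  simp [add_comm]

theorem measurable_measure_add_le (ν : Measure ℝ≥0) [SFinite ν] (a : ℝ≥0) :
    Measurable fun x : ℝ≥0 => ν {y | x + y ≤ a} :=
  measurable_measure_prodMk_left
    (measurableSet_le (measurable_fst.add measurable_snd) measurable_const)

theorem setOf_add_le_eq_Iic {x a : ℝ≥0} (h : x ≤ a) : {y | x + y ≤ a} = Iic (a - x) := by
  ext y
  simp [le_tsub_iff_left h]

theorem setOf_add_le_eq_empty {x a : ℝ≥0} (h : a < x) : {y | x + y ≤ a} = ∅ := by
  ext y
  simpa using h.trans_le le_self_add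

/-- Convolving with a measure that charges `[0, a)` preserves strict inequality of CDFs. -/
theorem mconv_Iic_lt_mconv_Iic {μ ν ρ : Measure ℝ≥0} [IsFiniteMeasure μ] [IsFiniteMeasure ν]
    [IsFiniteMeasure ρ] {a : ℝ≥0} (hle : ∀ t, μ (Iic t) ≤ ν (Iic t))
    (hlt : ∀ t, 0 < t → μ (Iic t) < ν (Iic t)) (hρ : ρ (Iio a) ≠ 0) :
    mconv ρ μ (Iic a) < mconv ρ ν (Iic a) := by
  have hfin : mconv ρ μ (Iic a) ≠ ∞ := by
    unfold mconv
    exact measure_ne_top _ _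
  rw [mconv_Iic_eq_lintegral] at hfin ⊢
  rw [mconv_Iic_eq_lintegral]
  refine lintegral_strict_mono_of_ae_le_of_ae_lt_on
    (measurable_measure_add_le ν a).aemeasurable hfin (.of_forall fun x => ?_) hρ
    (.of_forall fun x hx => ?_)
  · rcases le_or_gt x a with h | h
    · simpa only [setOf_add_le_eq_Iic h] using hle _
    · simp [setOf_add_le_eq_empty h]
  · simpa only [setOf_add_le_eq_Iic (le_of_lt hx)] using hlt _ (tsub_pos_of_lt hx)

/-- Parallel timing anomaly for minimum composition: even though `Exp 2` dominates
`Exp 0.5` pointwise, the convolution `Exp 1 ∗ Exp 0.5` (the min-composed rates of the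
faster component with the context) assigns less probability to `[0,2]` than
`Exp 0.5 ∗ Exp 2` (the min-composed rates of the slower component) does. -/
theorem minimum_composition_timing_anomaly
    (e1 e05 e2 : Measure ℝ≥0)
    (h1p : IsProbabilityMeasure e1) (h05p : IsProbabilityMeasure e05)
    (h2p : IsProbabilityMeasure e2)
    (h1 : ∀ t : ℝ≥0, e1 (Set.Iic t) = ENNReal.ofReal (1 - Real.exp (-(1 * t))))
    (h05 : ∀ t : ℝ≥0, e05 (Set.Iic t) = ENNReal.ofReal (1 - Real.exp (-((1/2) * t))))
    (h2 : ∀ t : ℝ≥0, e2 (Set.Iic t) = ENNReal.ofReal (1 - Real.exp (-(2 * t)))) :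
    (∀ t : ℝ≥0, e05 (Set.Iic t) ≤ e2 (Set.Iic t)) ∧
    mconv e1 e05 (Set.Iic 2) < mconv e05 e2 (Set.Iic 2) := by
  have exp_le {r s : ℝ} (hrs : r ≤ s) (t : ℝ≥0) :
      ENNReal.ofReal (1 - Real.exp (-(r * t))) ≤ ENNReal.ofReal (1 - Real.exp (-(s * t))) := by
    gcongr
  refine ⟨fun t => ?_, ?_⟩
  · rw [h05, h2]
    exact exp_le (by norm_num) t
  rw [mconv_comm]
  refine mconv_Iic_lt_mconv_Iic (fun t => ?_) (fun t ht => ?_) (ne_of_gt ?_)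
  · rw [h1, h2]
    exact exp_le (by norm_num) t
  · have ht' : (0 : ℝ) < t := ht
    rw [h1, h2, ENNReal.ofReal_lt_ofReal_iff_of_nonneg]
    · gcongr
      norm_num
    · simp
  · refine lt_of_lt_of_le ?_ (measure_mono (Iic_subset_Iio.2 one_lt_two))
    rw [h05]
    simp
end

section
/- Strong monotonicity prevents parallel timing anomalies: let L be a finite nonempty label set, let U, V, W, W' be SMDPs over L, and let ⋆ be a residence-time composition function. If (U,W) ◀⋆ (V,W') (⋆ is strongly monotonic in U, V, W, W'), U ⪯ V, and W ⪯ W', then U ∥⋆ W ⪯ V ∥⋆ W'. -/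
open MeasureTheory Set
open scoped NNReal ENNReal

variable {L : Type}

/-- The `⋆`-composition of two SMDPs, where `star` is a residence-time composition
function mapping probability measures to probability measures. -/
noncomputable def compSMDP (star : Measure ℝ≥0 → Measure ℝ≥0 → Measure ℝ≥0)
    (hstar : ∀ μ ν : Measure ℝ≥0, IsProbabilityMeasure μ → IsProbabilityMeasure ν →
      IsProbabilityMeasure (star μ ν))
    (U W : SMDP L) : SMDP L where
  S := U.S × W.S
  countS := inferInstance
  neS := inferInstance
  init := (U.init, W.init)
  τ := fun s a s' => U.τ s.1 a s'.1 * W.τ s.2 a s'.2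
  sub_prob := by
    intro s a
    calc (∑' s' : U.S × W.S, ((U.τ s.1 a s'.1 * W.τ s.2 a s'.2 : ℝ≥0) : ℝ≥0∞))
        = ∑' u', ∑' w', (U.τ s.1 a u' : ℝ≥0∞) * (W.τ s.2 a w' : ℝ≥0∞) := by
          rw [ENNReal.tsum_prod']; simp [ENNReal.coe_mul]
      _ = (∑' u', (U.τ s.1 a u' : ℝ≥0∞)) * (∑' w', (W.τ s.2 a w' : ℝ≥0∞)) := by
          simp [ENNReal.tsum_mul_left, ENNReal.tsum_mul_right]
      _ ≤ 1 * 1 := mul_le_mul' (U.sub_prob s.1 a) (W.sub_prob s.2 a)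
      _ = 1 := one_mul 1
  ρ := fun s => star (U.ρ s.1) (W.ρ s.2)
  ρ_prob := fun s => hstar _ _ (U.ρ_prob s.1) (W.ρ_prob s.2)

/-- An SMDP has a deterministic Markov kernel if for every state and label at most one
successor state has positive transition probability. -/
def DetKernel (M : SMDP L) : Prop :=
  ∀ (s : M.S) (a : L) (s₁ s₂ : M.S), M.τ s a s₁ ≠ 0 → M.τ s a s₂ ≠ 0 → s₁ = s₂

/-- A state path of length `n`: it starts in the initial state, and each step has
positive transition probability for some label. -/
def IsStatePath (M : SMDP L) {n : ℕ} (p : Fin n → M.S) : Prop :=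
  (∀ h : 0 < n, p ⟨0, h⟩ = M.init) ∧
  (∀ (i : ℕ) (h : i + 1 < n), ∃ a : L,
    M.τ (p ⟨i, Nat.lt_of_succ_lt h⟩) a (p ⟨i + 1, h⟩) ≠ 0)

/-- `⋆` is `n`-monotonic in `U`, `V`, `W`, `W'`: written `(U,W) ◁ⁿ⋆ (V,W')`. -/
def NMonotonic (star : Measure ℝ≥0 → Measure ℝ≥0 → Measure ℝ≥0)
    (hstar : ∀ μ ν : Measure ℝ≥0, IsProbabilityMeasure μ → IsProbabilityMeasure ν →
      IsProbabilityMeasure (star μ ν))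
    (U V W W' : SMDP L) (n : ℕ) : Prop :=
  DetKernel W' ∧
  ∀ (pu : Fin n → U.S) (pv : Fin n → V.S) (pw : Fin n → W.S) (pw' : Fin n → W'.S),
    IsStatePath U pu → IsStatePath V pv → IsStatePath W pw → IsStatePath W' pw' →
    ((∀ (i : Fin n) (t : ℝ≥0),
        U.ρ (pu i) (Set.Iic t) ≤ star (U.ρ (pu i)) (W.ρ (pw i)) (Set.Iic t)) ∧
     (∀ (i : Fin n) (t : ℝ≥0),
        star (V.ρ (pv i)) (W'.ρ (pw' i)) (Set.Iic t) ≤ V.ρ (pv i) (Set.Iic t)) ∧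
     (∀ σU : Scheduler U, ∃ σUW : Scheduler (compSMDP star hstar U W),
        ∀ (a : L) (i : ℕ) (h : i + 1 < n),
          schedTau U σU (pu ⟨i, Nat.lt_of_succ_lt h⟩) a (pu ⟨i + 1, h⟩) ≤
          schedTau (compSMDP star hstar U W) σUW
            (pu ⟨i, Nat.lt_of_succ_lt h⟩, pw ⟨i, Nat.lt_of_succ_lt h⟩) a
            (pu ⟨i + 1, h⟩, pw ⟨i + 1, h⟩)) ∧
     (∀ σVW' : Scheduler (compSMDP star hstar V W'), ∃ σV : Scheduler V,
        ∀ (a : L) (i : ℕ) (h : i + 1 < n),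
          schedTau (compSMDP star hstar V W') σVW'
            (pv ⟨i, Nat.lt_of_succ_lt h⟩, pw' ⟨i, Nat.lt_of_succ_lt h⟩) a
            (pv ⟨i + 1, h⟩, pw' ⟨i + 1, h⟩) ≤
          schedTau V σV (pv ⟨i, Nat.lt_of_succ_lt h⟩) a (pv ⟨i + 1, h⟩)))

/-- `⋆` is strongly `n`-monotonic in `U`, `V`, `W`, `W'`: written `(U,W) ◀ⁿ⋆ (V,W')`.
The existential quantifiers over schedulers in `n`-monotonicity are strengthened to
universal ones. -/
def StrongNMonotonic (star : Measure ℝ≥0 → Measure ℝ≥0 → Measure ℝ≥0)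
    (hstar : ∀ μ ν : Measure ℝ≥0, IsProbabilityMeasure μ → IsProbabilityMeasure ν →
      IsProbabilityMeasure (star μ ν))
    (U V W W' : SMDP L) (n : ℕ) : Prop :=
  DetKernel W' ∧
  ∀ (pu : Fin n → U.S) (pv : Fin n → V.S) (pw : Fin n → W.S) (pw' : Fin n → W'.S),
    IsStatePath U pu → IsStatePath V pv → IsStatePath W pw → IsStatePath W' pw' →
    ((∀ (i : Fin n) (t : ℝ≥0),
        U.ρ (pu i) (Set.Iic t) ≤ star (U.ρ (pu i)) (W.ρ (pw i)) (Set.Iic t)) ∧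
     (∀ (i : Fin n) (t : ℝ≥0),
        star (V.ρ (pv i)) (W'.ρ (pw' i)) (Set.Iic t) ≤ V.ρ (pv i) (Set.Iic t)) ∧
     (∀ (σU : Scheduler U) (σUW : Scheduler (compSMDP star hstar U W)),
        ∀ (a : L) (i : ℕ) (h : i + 1 < n),
          schedTau U σU (pu ⟨i, Nat.lt_of_succ_lt h⟩) a (pu ⟨i + 1, h⟩) ≤
          schedTau (compSMDP star hstar U W) σUW
            (pu ⟨i, Nat.lt_of_succ_lt h⟩, pw ⟨i, Nat.lt_of_succ_lt h⟩) a
            (pu ⟨i + 1, h⟩, pw ⟨i + 1, h⟩)) ∧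
     (∀ (σVW' : Scheduler (compSMDP star hstar V W')) (σV : Scheduler V),
        ∀ (a : L) (i : ℕ) (h : i + 1 < n),
          schedTau (compSMDP star hstar V W') σVW'
            (pv ⟨i, Nat.lt_of_succ_lt h⟩, pw' ⟨i, Nat.lt_of_succ_lt h⟩) a
            (pv ⟨i + 1, h⟩, pw' ⟨i + 1, h⟩) ≤
          schedTau V σV (pv ⟨i, Nat.lt_of_succ_lt h⟩) a (pv ⟨i + 1, h⟩)))

lemma mconv_apply_Iic_s12 (μ ν : Measure ℝ≥0) [SFinite μ] [SFinite ν] (t : ℝ≥0) :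
    mconv μ ν (Iic t) = (μ.prod ν) {p | p.1 + p.2 ≤ t} := by
  rw [mconv, Measure.map_apply (by fun_prop) measurableSet_Iic]
  rfl

lemma measure_add_le_mono {ν ν' : Measure ℝ≥0} (h : ∀ t, ν (Iic t) ≤ ν' (Iic t)) (x t : ℝ≥0) :
    ν {y | x + y ≤ t} ≤ ν' {y | x + y ≤ t} := by
  by_cases hx : x ≤ t
  · have : {y | x + y ≤ t} = Iic (t - x) := by
      ext y
      simp [le_tsub_iff_left hx]
    rw [this]
    exact h _
  · have : {y | x + y ≤ t} = ∅ := by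
      ext y
      simp only [mem_ofPred_eq, mem_empty_iff_false, iff_false]
      exact fun hy => hx (le_self_add.trans hy)
    simp [this]

lemma mconv_Iic_mono {μ μ' ν ν' : Measure ℝ≥0} [SFinite μ] [SFinite μ'] [SFinite ν] [SFinite ν']
    (hμ : ∀ t, μ (Iic t) ≤ μ' (Iic t)) (hν : ∀ t, ν (Iic t) ≤ ν' (Iic t)) (t : ℝ≥0) :
    mconv μ ν (Iic t) ≤ mconv μ' ν' (Iic t) := by
  have hm : MeasurableSet {p : ℝ≥0 × ℝ≥0 | p.1 + p.2 ≤ t} :=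
    measurableSet_le (by fun_prop) measurable_const
  rw [mconv_apply_Iic_s12, mconv_apply_Iic_s12]
  calc (μ.prod ν) {p | p.1 + p.2 ≤ t} ≤ (μ.prod ν') {p | p.1 + p.2 ≤ t} := by
        rw [Measure.prod_apply hm, Measure.prod_apply hm]
        exact lintegral_mono fun x => measure_add_le_mono hν x t
    _ ≤ (μ'.prod ν') {p | p.1 + p.2 ≤ t} := by
        rw [Measure.prod_apply_symm hm, Measure.prod_apply_symm hm]
        refine lintegral_mono fun y => ?_
        simpa only [preimage_ofPred_eq, add_comm] using measure_add_le_mono hμ y t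

instance convAlong_isProbabilityMeasure (M : SMDP L) (s : M.S) (p : List M.S) :
    IsProbabilityMeasure (convAlong M s p) := by
  induction p generalizing s with
  | nil => exact M.ρ_prob s
  | cons s' p ih =>
    have := ih s'
    rw [convAlong, mconv]
    exact Measure.isProbabilityMeasure_map (by fun_prop)

lemma exists_measure_Iic_ne_zero (μ : Measure ℝ≥0) [IsProbabilityMeasure μ] :
    ∃ t, μ (Iic t) ≠ 0 := by
  by_contra! h
  have h0 : μ (⋃ n : ℕ, Iic (n : ℝ≥0)) = 0 := measure_iUnion_null fun n => h n
  have hu : (⋃ n : ℕ, Iic (n : ℝ≥0)) = univ := by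
    ext x
    simpa using exists_nat_ge x
  rw [hu, measure_univ] at h0
  exact one_ne_zero h0

/-- Pointwise domination of residence times along two paths of equal length dominates the
convolutions along them. -/
lemma convAlong_dropLast_mono {M N : SMDP L} (d : M.S) (e : N.S) (s : M.S) (s' : N.S)
    (p : List M.S) (q : List N.S) (hlen : p.length = q.length) (hp : p ≠ [])
    (h : ∀ i < p.length, ∀ t, M.ρ ((s :: p).getD i d) (Iic t) ≤ N.ρ ((s' :: q).getD i e) (Iic t))
    (t : ℝ≥0) :
    convAlong M s p.dropLast (Iic t) ≤ convAlong N s' q.dropLast (Iic t) := by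
  induction p generalizing s s' q t with
  | nil => exact absurd rfl hp
  | cons x p ih =>
    obtain _ | ⟨y, q⟩ := q
    · simp at hlen
    have h0 : ∀ t, M.ρ s (Iic t) ≤ N.ρ s' (Iic t) := by simpa using h 0 (by simp)
    obtain _ | ⟨x', p⟩ := p
    · obtain _ | ⟨y', q⟩ := q
      · exact h0 t
      · simp at hlen
    · obtain _ | ⟨y', q⟩ := q
      · simp at hlen
      refine mconv_Iic_mono h0 (ih x y (y' :: q) (by simpa using hlen) (by simp) ?_) t
      intro i hi t
      simpa using h (i + 1) (by simpa using hi) t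

/-- Pointwise domination of transition probabilities along two paths of equal length dominates
the path weights. -/
lemma pathWeight_mono {M N : SMDP L} (σ : Scheduler M) (σ' : Scheduler N) (d : M.S) (e : N.S)
    (s : M.S) (s' : N.S) (w : List L) (p : List M.S) (q : List N.S)
    (hlen : p.length = q.length)
    (h : ∀ i < w.length, ∀ a, schedTau M σ ((s :: p).getD i d) a ((s :: p).getD (i + 1) d) ≤
      schedTau N σ' ((s' :: q).getD i e) a ((s' :: q).getD (i + 1) e)) :
    pathWeight M σ s w p ≤ pathWeight N σ' s' w q := by
  induction w generalizing s s' p q with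
  | nil =>
    obtain _ | ⟨x, p⟩ := p <;> obtain _ | ⟨y, q⟩ := q <;> simp_all [pathWeight]
  | cons a w ih =>
    obtain _ | ⟨x, p⟩ := p <;> obtain _ | ⟨y, q⟩ := q
    · simp [pathWeight]
    · simp at hlen
    · simp at hlen
    · rw [pathWeight, pathWeight]
      refine mul_le_mul' ?_ (ih x y p q (by simpa using hlen) ?_)
      · have := h 0 (by simp) a
        exact ENNReal.coe_le_coe.2 (by simpa using this)
      · intro i hi a
        simpa using h (i + 1) (by simpa using hi) a

/-- `StepsAlong M s w p`: starting from `s`, the word `w` labels positive-probability steps through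
the states of `p`. -/
def StepsAlong (M : SMDP L) : M.S → List L → List M.S → Prop
  | _, [], [] => True
  | s, a :: w, s' :: p => M.τ s a s' ≠ 0 ∧ StepsAlong M s' w p
  | _, _, _ => False

lemma stepsAlong_of_pathWeight_ne_zero {M : SMDP L} {σ : Scheduler M} {s : M.S} {w : List L}
    {p : List M.S} (h : pathWeight M σ s w p ≠ 0) : StepsAlong M s w p := by
  induction w generalizing s p with
  | nil => cases p <;> simp_all [pathWeight, StepsAlong]
  | cons a w ih =>
    obtain _ | ⟨x, p⟩ := p
    · simp [pathWeight] at h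
    · simp only [pathWeight, schedTau, ENNReal.coe_mul, ne_eq, mul_eq_zero, not_or,
        ENNReal.coe_eq_zero] at h
      exact ⟨h.1.1, ih h.2⟩

lemma StepsAlong.pathWeight_ne_zero {M : SMDP L} {σ : Scheduler M} (hσ : ∀ s a, σ.f s a ≠ 0)
    {s : M.S} {w : List L} {p : List M.S} (h : StepsAlong M s w p) :
    pathWeight M σ s w p ≠ 0 := by
  induction w generalizing s p with
  | nil => cases p <;> simp_all [pathWeight, StepsAlong]
  | cons a w ih =>
    obtain _ | ⟨x, p⟩ := p
    · simp [StepsAlong] at h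
    · simp only [pathWeight, schedTau, ENNReal.coe_mul, ne_eq, mul_eq_zero, not_or,
        ENNReal.coe_eq_zero]
      exact ⟨⟨h.1, hσ _ _⟩, ih h.2⟩

lemma StepsAlong.length_eq {M : SMDP L} {s : M.S} {w : List L} {p : List M.S}
    (h : StepsAlong M s w p) : p.length = w.length := by
  induction w generalizing s p with
  | nil => cases p <;> simp_all [StepsAlong]
  | cons a w ih =>
    obtain _ | ⟨x, p⟩ := p
    · simp [StepsAlong] at h
    · simpa using ih h.2

lemma StepsAlong.exists_step {M : SMDP L} {s : M.S} {w : List L} {p : List M.S}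
    (h : StepsAlong M s w p) (d : M.S) {i : ℕ} (hi : i < w.length) :
    ∃ a, M.τ ((s :: p).getD i d) a ((s :: p).getD (i + 1) d) ≠ 0 := by
  induction w generalizing s p i with
  | nil => simp at hi
  | cons a w ih =>
    obtain _ | ⟨x, p⟩ := p
    · simp [StepsAlong] at h
    · cases i with
      | zero => exact ⟨a, by simpa using h.1⟩
      | succ i => simpa using ih h.2 (by simpa using hi)

lemma StepsAlong.isStatePath {M : SMDP L} {w : List L} {p : List M.S}
    (h : StepsAlong M M.init w p) :
    IsStatePath M (fun i : Fin (w.length + 1) => (M.init :: p).getD i M.init) :=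
  ⟨fun _ => rfl, fun _ hi => h.exists_step M.init (Nat.lt_of_succ_lt_succ hi)⟩

lemma StepsAlong.eq_of_detKernel {M : SMDP L} (hM : DetKernel M) {s : M.S} {w : List L}
    {p q : List M.S} (hp : StepsAlong M s w p) (hq : StepsAlong M s w q) : p = q := by
  induction w generalizing s p q with
  | nil => cases p <;> cases q <;> simp_all [StepsAlong]
  | cons a w ih =>
    obtain _ | ⟨x, p⟩ := p
    · simp [StepsAlong] at hp
    obtain _ | ⟨y, q⟩ := q
    · simp [StepsAlong] at hq
    obtain rfl := hM s a x y hp.1 hq.1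
    rw [ih hp.2 hq.2]

lemma StepsAlong.comp_components {star : Measure ℝ≥0 → Measure ℝ≥0 → Measure ℝ≥0}
    {hstar : ∀ μ ν : Measure ℝ≥0, IsProbabilityMeasure μ → IsProbabilityMeasure ν →
      IsProbabilityMeasure (star μ ν)}
    {U W : SMDP L} {u : U.S} {v : W.S} {w : List L} {r : List (U.S × W.S)}
    (h : StepsAlong (compSMDP star hstar U W) (u, v) w r) :
    StepsAlong U u w (r.map Prod.fst) ∧ StepsAlong W v w (r.map Prod.snd) := by
  induction w generalizing u v r with
  | nil => cases r <;> simp_all [StepsAlong]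
  | cons a w ih =>
    obtain _ | ⟨⟨x, y⟩, r⟩ := r
    · simp [StepsAlong] at h
    · obtain ⟨h1, h2⟩ := h
      exact ⟨⟨left_ne_zero_of_mul h1, (ih h2).1⟩, ⟨right_ne_zero_of_mul h1, (ih h2).2⟩⟩

/-- The scheduler choosing every label with equal probability. -/
noncomputable def uniformScheduler [Fintype L] [Nonempty L] (M : SMDP L) : Scheduler M where
  f _ _ := (Fintype.card L : ℝ≥0)⁻¹
  sum_one s := by
    have hc : (Fintype.card L : ℝ≥0) ≠ 0 := by simp
    rw [tsum_fintype, Finset.sum_const, Finset.card_univ, nsmul_eq_mul]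
    exact_mod_cast mul_inv_cancel₀ hc

/-- A faster process has a positive-probability path along every word that the slower one has. -/
lemma Faster.exists_stepsAlong [Fintype L] [Nonempty L] {U V : SMDP L} (hUV : Faster U V)
    {w : List L} (hw : w ≠ []) {p : List V.S} (hp : StepsAlong V V.init w p) :
    ∃ q, StepsAlong U U.init w q := by
  obtain ⟨t, ht⟩ := exists_measure_Iic_ne_zero (convAlong V V.init p.dropLast)
  obtain ⟨σ', t', -, hle⟩ := hUV (uniformScheduler V) w hw t
  have hV : cylP V (uniformScheduler V) V.init w t ≠ 0 := by
    refine ENNReal.summable.tsum_ne_zero_iff.2 ⟨p, mul_ne_zero ?_ ht⟩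
    exact hp.pathWeight_ne_zero fun _ _ => by simp [uniformScheduler]
  obtain ⟨q, hq⟩ := ENNReal.summable.tsum_ne_zero_iff.1 (ne_bot_of_le_ne_bot hV hle)
  exact ⟨q, stepsAlong_of_pathWeight_ne_zero (left_ne_zero_of_mul hq)⟩

lemma getD_pair {X Y : Type} (r : List (X × Y)) (i : ℕ) (d : X × Y) :
    r.getD i d = ((r.map Prod.fst).getD i d.1, (r.map Prod.snd).getD i d.2) := by
  rw [List.getD_map, List.getD_map]

lemma list_ext_of_map_fst_of_map_snd {X Y : Type} {r r' : List (X × Y)}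
    (h₁ : r.map Prod.fst = r'.map Prod.fst) (h₂ : r.map Prod.snd = r'.map Prod.snd) : r = r' := by
  rw [← List.zip_unzip r, ← List.zip_unzip r', List.unzip_eq_map, List.unzip_eq_map, h₁, h₂]

lemma ENNReal.tsum_le_tsum_of_injOn_support {α β : Type*} {f : α → ℝ≥0∞} {g : β → ℝ≥0∞}
    (e : α → β) (he : InjOn e (Function.support f)) (h : ∀ x, f x ≠ 0 → f x ≤ g (e x)) :
    ∑' x, f x ≤ ∑' y, g y := by
  rw [← tsum_subtype_support f]
  calc ∑' x : Function.support f, f x ≤ ∑' x : Function.support f, g (e x) :=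
        ENNReal.tsum_le_tsum fun x => h x x.2
    _ ≤ ∑' y, g y :=
        ENNReal.tsum_comp_le_tsum_of_injective (f := fun x : Function.support f => e x)
          (injOn_iff_injective.1 he) g

/-- Strong monotonicity prevents parallel timing anomalies: if `⋆` is a (commutative,
probability-preserving) residence-time composition function that is strongly monotonic in
`U`, `V`, `W`, `W'`, and `U ⪯ V` and `W ⪯ W'`, then `U ∥⋆ W ⪯ V ∥⋆ W'`. -/
theorem strongly_monotonic_no_timing_anomaly (L : Type) [Fintype L] [Nonempty L]
    (star : Measure ℝ≥0 → Measure ℝ≥0 → Measure ℝ≥0)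
    (hcomm : ∀ μ ν : Measure ℝ≥0, star μ ν = star ν μ)
    (hstar : ∀ μ ν : Measure ℝ≥0, IsProbabilityMeasure μ → IsProbabilityMeasure ν →
      IsProbabilityMeasure (star μ ν))
    (U V W W' : SMDP L)
    (hmon : ∀ n : ℕ, StrongNMonotonic star hstar U V W W' n)
    (hUV : Faster U V) (hWW' : Faster W W') :
    Faster (compSMDP star hstar U W) (compSMDP star hstar V W') := by
  intro σ w hw t
  by_cases h0 : cylP (compSMDP star hstar V W') σ (compSMDP star hstar V W').init w t = 0
  · exact ⟨uniformScheduler _, t, le_rfl, h0 ▸ zero_le⟩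
  obtain ⟨r₀, hr₀⟩ := ENNReal.summable.tsum_ne_zero_iff.1 h0
  obtain ⟨hv₀, hw'₀⟩ :=
    (stepsAlong_of_pathWeight_ne_zero (left_ne_zero_of_mul hr₀)).comp_components
  obtain ⟨pu₀, hu₀⟩ := hUV.exists_stepsAlong hw hv₀
  obtain ⟨pw₀, hw₀⟩ := hWW'.exists_stepsAlong hw hw'₀
  obtain ⟨hdet, hquad⟩ := hmon (w.length + 1)
  have ne_nil_of_steps {M : SMDP L} {s : M.S} {p : List M.S} (h : StepsAlong M s w p) :
      p ≠ [] := by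
    rw [← List.length_pos_iff, h.length_eq]
    exact List.length_pos_iff.2 hw
  have upper : cylP (compSMDP star hstar V W') σ (compSMDP star hstar V W').init w t ≤
      cylP V (uniformScheduler V) V.init w t := by
    refine ENNReal.tsum_le_tsum_of_injOn_support (List.map Prod.fst) ?_ ?_
    · intro r hr r' hr' heq
      have h1 := (stepsAlong_of_pathWeight_ne_zero (left_ne_zero_of_mul hr)).comp_components.2
      have h2 := (stepsAlong_of_pathWeight_ne_zero (left_ne_zero_of_mul hr')).comp_components.2
      exact list_ext_of_map_fst_of_map_snd heq (h1.eq_of_detKernel hdet h2)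
    · intro r hr
      have hs := stepsAlong_of_pathWeight_ne_zero (left_ne_zero_of_mul hr)
      obtain ⟨hv, hw'⟩ := hs.comp_components
      obtain ⟨-, hρ, -, hτ⟩ := hquad _ _ _ _ hu₀.isStatePath hv.isStatePath hw₀.isStatePath
        hw'.isStatePath
      have hget (i : ℕ) := getD_pair ((V.init, W'.init) :: r) i (V.init, W'.init)
      refine mul_le_mul'
        (pathWeight_mono _ _ (compSMDP star hstar V W').init V.init _ _ _ _ _
          (List.length_map _).symm ?_)
        (convAlong_dropLast_mono (compSMDP star hstar V W').init V.init _ _ _ _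
          (List.length_map _).symm (ne_nil_of_steps hs) ?_ t)
      · intro i hi a
        have := hτ σ (uniformScheduler V) a i (by omega)
        exact (congrArg₂ (schedTau _ _ · a ·) (hget i) (hget (i + 1))).trans_le this
      · intro i hi t
        have := hρ ⟨i, by rw [hs.length_eq] at hi; omega⟩ t
        exact (congrArg (fun s => (compSMDP star hstar V W').ρ s (Iic t)) (hget i)).trans_le this
  obtain ⟨σU, t', ht', hle⟩ := hUV (uniformScheduler V) w hw t
  refine ⟨uniformScheduler _, t', ht', upper.trans (hle.trans ?_)⟩
  refine ENNReal.tsum_le_tsum_of_injOn_support (fun p => p.zip pw₀) ?_ ?_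
  · intro p hp p' hp' heq
    have h1 := (stepsAlong_of_pathWeight_ne_zero (left_ne_zero_of_mul hp)).length_eq
    have h2 := (stepsAlong_of_pathWeight_ne_zero (left_ne_zero_of_mul hp')).length_eq
    have h3 := hw₀.length_eq
    have := congrArg (List.map Prod.fst) heq
    rwa [List.map_fst_zip (by omega), List.map_fst_zip (by omega)] at this
  · intro p hp
    have hu := stepsAlong_of_pathWeight_ne_zero (left_ne_zero_of_mul hp)
    have hlen : p.length = pw₀.length := hu.length_eq.trans hw₀.length_eq.symm
    obtain ⟨hρ, -, hτ, -⟩ := hquad _ _ _ _ hu.isStatePath hv₀.isStatePath hw₀.isStatePath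
      hw'₀.isStatePath
    have hget (i : ℕ) : ((U.init, W.init) :: p.zip pw₀).getD i (U.init, W.init) =
        ((U.init :: p).getD i U.init, (W.init :: pw₀).getD i W.init) := by
      rw [getD_pair, List.map_cons, List.map_cons, List.map_fst_zip hlen.le,
        List.map_snd_zip hlen.ge]
    have hlen' : p.length = (p.zip pw₀).length := by simp [hlen]
    refine mul_le_mul'
      (pathWeight_mono _ _ U.init (compSMDP star hstar U W).init _ _ _ _ _
        hlen' ?_)
      (convAlong_dropLast_mono U.init (compSMDP star hstar U W).init _ _ _ _
        hlen' (ne_nil_of_steps hu) ?_ t')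
    · intro i hi a
      have := hτ σU (uniformScheduler _) a i (by omega)
      exact this.trans_eq (congrArg₂ (schedTau _ _ · a ·) (hget i) (hget (i + 1))).symm
    · intro i hi t
      have := hρ ⟨i, by rw [hu.length_eq] at hi; omega⟩ t
      exact this.trans_eq (congrArg (fun s => (compSMDP star hstar U W).ρ s (Iic t)) (hget i)).symm
end
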